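/- Let 1 < p < ∞ and m ≥ 0. There exists a positive integer N, depending only on p and m, such that for every x in the linear span of {h_i^{(p)} : 0 ≤ i ≤ m} in L_p[0,1], every DGA residual sequence (x_n)_{n≥0} for the dictionary {h_i^{(p)} : 0 ≤ i ≤ m} starting at x satisfies x_N = 0. -/

import Mathlib

open MeasureTheory

/-- The Haar functions on `[0,1]` (extended by `0` to all of `ℝ`): `haarFn 0` is the
indicator of `[0,1)` (i.e. `h₀ ≡ 1` on `[0,1]` up to the single point `1`), and for
`i = 2^n + k` with `0 ≤ k < 2^n` (so that `n = Nat.log 2 i`), `haarFn i` is `1` on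
`[k/2^n, (2k+1)/2^(n+1))`, `-1` on `[(2k+1)/2^(n+1), (k+1)/2^n)` and `0` elsewhere. -/
noncomputable def haarFn (i : ℕ) : ℝ → ℝ :=
  if i = 0 then Set.indicator (Set.Ico (0 : ℝ) 1) 1
  else
    let n := Nat.log 2 i
    let k := i - 2 ^ n
    fun t =>
      Set.indicator (Set.Ico ((k : ℝ) / 2 ^ n) ((2 * (k : ℝ) + 1) / 2 ^ (n + 1))) 1 t -
        Set.indicator (Set.Ico ((2 * (k : ℝ) + 1) / 2 ^ (n + 1)) (((k : ℝ) + 1) / 2 ^ n)) 1 t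

/-- The `L_p[0,1]` norm of a function `f : ℝ → ℝ`. -/
noncomputable def pnorm (p : ℝ) (f : ℝ → ℝ) : ℝ :=
  (eLpNorm f (ENNReal.ofReal p) (volume.restrict (Set.Ico (0 : ℝ) 1))).toReal

/-- The `L_p`-normalized Haar function `h_i^{(p)} = h_i / ‖h_i‖_p`. -/
noncomputable def haarFnP (p : ℝ) (i : ℕ) : ℝ → ℝ :=
  fun t => haarFn i t / pnorm p (haarFn i)

/-- The norming functional of a nonzero `y ∈ L_p[0,1]` applied to `g`:
`F_y(g) = ‖y‖_p^{1−p} ∫₀¹ sign(y(t)) |y(t)|^{p−1} g(t) dt`. -/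
noncomputable def normingF (p : ℝ) (y g : ℝ → ℝ) : ℝ :=
  pnorm p y ^ (1 - p) *
    ∫ t in Set.Ico (0 : ℝ) 1, Real.sign (y t) * |y t| ^ (p - 1) * g t

/-- The odd power function `u ↦ sign u · |u| ^ (p - 1)`. -/
noncomputable def signedPow (p u : ℝ) : ℝ := Real.sign u * |u| ^ (p - 1)

section signedPow

variable {p : ℝ}

lemma signedPow_eq_sub (hp : 1 < p) (u : ℝ) :
    signedPow p u = max u 0 ^ (p - 1) - max (-u) 0 ^ (p - 1) := by
  have h0 : (0 : ℝ) ^ (p - 1) = 0 := Real.zero_rpow (by linarith)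
  rcases lt_trichotomy u 0 with h | rfl | h
  · rw [signedPow, Real.sign_of_neg h, abs_of_neg h, max_eq_right h.le,
      max_eq_left (by linarith), h0]
    ring
  · simp [signedPow]
  · rw [signedPow, Real.sign_of_pos h, abs_of_pos h, max_eq_left h.le,
      max_eq_right (by linarith), h0]
    ring

lemma continuous_signedPow (hp : 1 < p) : Continuous (signedPow p) := by
  have hp' : 0 ≤ p - 1 := by linarith
  simp_rw [funext (signedPow_eq_sub hp)]
  exact ((continuous_id.max continuous_const).rpow_const fun _ => Or.inr hp').sub
    ((continuous_neg.max continuous_const).rpow_const fun _ => Or.inr hp')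

lemma strictMono_signedPow (hp : 1 < p) : StrictMono (signedPow p) := by
  intro u v huv
  have hp' : 0 < p - 1 := by linarith
  rw [signedPow_eq_sub hp, signedPow_eq_sub hp]
  have mono : ∀ a b : ℝ, a ≤ b → max a 0 ^ (p - 1) ≤ max b 0 ^ (p - 1) := fun a b hab =>
    Real.rpow_le_rpow (le_max_right _ _) (max_le_max_right _ hab) hp'.le
  rcases le_or_gt v 0 with hv | hv
  · have h1 : max (-v) 0 ^ (p - 1) < max (-u) 0 ^ (p - 1) :=
      Real.rpow_lt_rpow (le_max_right _ _)
        (by rw [max_eq_left (by linarith), max_eq_left (by linarith)]; linarith) hp'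
    linarith [mono u v huv.le]
  · have h1 : max u 0 ^ (p - 1) < max v 0 ^ (p - 1) :=
      Real.rpow_lt_rpow (le_max_right _ _)
        (by rw [max_eq_left hv.le]; exact max_lt huv hv) hp'
    linarith [mono (-v) (-u) (by linarith)]

lemma abs_signedPow_le (u : ℝ) : |signedPow p u| ≤ |u| ^ (p - 1) := by
  rw [signedPow, abs_mul, abs_of_nonneg (Real.rpow_nonneg (abs_nonneg u) _)]
  refine mul_le_of_le_one_left (Real.rpow_nonneg (abs_nonneg u) _) ?_
  rcases Real.sign_apply_eq u with h | h | h <;> simp [h]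

lemma sign_mul_self_eq_abs (u : ℝ) : Real.sign u * u = |u| := by
  rcases lt_trichotomy u 0 with h | rfl | h
  · rw [Real.sign_of_neg h, abs_of_neg h, neg_one_mul]
  · simp
  · rw [Real.sign_of_pos h, abs_of_pos h, one_mul]

lemma signedPow_mul_self (hp : 1 < p) (u : ℝ) : signedPow p u * u = |u| ^ p := by
  rcases eq_or_ne u 0 with rfl | h
  · simp [Real.zero_rpow (by linarith : p ≠ 0)]
  · rw [signedPow, mul_right_comm, sign_mul_self_eq_abs, ← Real.rpow_one_add' (abs_nonneg u)
      (by linarith)]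
    congr 1
    ring

/-- The graph of the convex function `|·| ^ p` lies above its tangents. -/
lemma abs_rpow_add_le (hp : 1 < p) (u v : ℝ) :
    |u| ^ p + p * signedPow p u * (v - u) ≤ |v| ^ p := by
  have hpq := Real.HolderConjugate.conjExponent hp
  have young := Real.young_inequality_of_nonneg (abs_nonneg v)
    (Real.rpow_nonneg (abs_nonneg u) (p - 1)) hpq
  have hq : (|u| ^ (p - 1)) ^ p.conjExponent = |u| ^ p := by
    rw [← Real.rpow_mul (abs_nonneg u), Real.conjExponent, mul_div_cancel₀ _ (by linarith)]
  rw [hq, Real.conjExponent] at young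
  have hle : signedPow p u * v ≤ |v| * |u| ^ (p - 1) := by
    calc signedPow p u * v ≤ |signedPow p u * v| := le_abs_self _
      _ = |v| * |signedPow p u| := by rw [abs_mul, mul_comm]
      _ ≤ _ := by gcongr; exact abs_signedPow_le u
  have key : p * (signedPow p u * v) ≤ |v| ^ p + (p - 1) * |u| ^ p := by
    calc p * (signedPow p u * v)
        ≤ p * (|v| ^ p / p + |u| ^ p / (p / (p - 1))) := by gcongr; exact hle.trans young
      _ = _ := by
        have : p - 1 ≠ 0 := by linarith
        field_simp
  linarith [signedPow_mul_self hp u, congrArg (p * ·) (signedPow_mul_self hp u)]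

lemma signedPow_mul {s : ℝ} (hs : 0 < s) (u : ℝ) :
    signedPow p (s * u) = s ^ (p - 1) * signedPow p u := by
  rw [signedPow, signedPow, abs_mul, abs_of_pos hs, Real.mul_rpow hs.le (abs_nonneg u)]
  have : Real.sign (s * u) = Real.sign u := by
    rcases lt_trichotomy u 0 with h | rfl | h
    · rw [Real.sign_of_neg h, Real.sign_of_neg (mul_neg_of_pos_of_neg hs h)]
    · simp
    · rw [Real.sign_of_pos h, Real.sign_of_pos (mul_pos hs h)]
  rw [this]
  ring

end signedPow

/-- A finite ordered family of functions with the structure of an initial segment of the Haar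
system: values in `{-1, 0, 1}`, every member but the first has mean zero, and each member is constant
on the supports of the later ones. -/
structure IsHaarLike {Ω : Type*} [MeasurableSpace Ω] (μ : Measure Ω) {d : ℕ}
    (h : Fin (d + 1) → Ω → ℝ) : Prop where
  measurable : ∀ i, Measurable (h i)
  exists_eq_on_support : ∀ i j, j < i → ∃ b, ∀ t, h i t ≠ 0 → h j t = b
  abs_eq_one : ∀ i t, h i t ≠ 0 → |h i t| = 1
  integral_eq_zero : ∀ i, 0 < i → ∫ t, h i t ∂μ = 0
  measure_support_pos : ∀ i, 0 < μ (Function.support (h i))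

/-- The function with coefficients `c` with respect to the family `h`. -/
def synth {Ω : Type*} {d : ℕ} (h : Fin (d + 1) → Ω → ℝ) (c : Fin (d + 1) → ℝ) (t : Ω) : ℝ :=
  ∑ j, c j * h j t

/-- The `p`-th power of the `L_p` norm of the function with coefficients `c`. -/
noncomputable def energy {Ω : Type*} [MeasurableSpace Ω] (p : ℝ) (μ : Measure Ω) {d : ℕ}
    (h : Fin (d + 1) → Ω → ℝ) (c : Fin (d + 1) → ℝ) : ℝ :=
  ∫ t, |synth h c t| ^ p ∂μ

/-- The unnormalized norming functional of the function with coefficients `c`, evaluated at the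
members of the family `h`. -/
noncomputable def dualCoeff {Ω : Type*} [MeasurableSpace Ω] (p : ℝ) (μ : Measure Ω) {d : ℕ}
    (h : Fin (d + 1) → Ω → ℝ) (c : Fin (d + 1) → ℝ) (j : Fin (d + 1)) : ℝ :=
  ∫ t, signedPow p (synth h c t) * h j t ∂μ

/-- A step of the weak dual greedy algorithm with weakness parameter `ρ`, in terms of
coefficients. -/
def WeakDualGreedyStep {Ω : Type*} [MeasurableSpace Ω] (p ρ : ℝ) (μ : Measure Ω) {d : ℕ}
    (h : Fin (d + 1) → Ω → ℝ) (c c' : Fin (d + 1) → ℝ) : Prop :=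
  ∃ (i : Fin (d + 1)) (t : ℝ), c' = c - Pi.single i t ∧
    (∀ j, ρ * |dualCoeff p μ h c j| ≤ |dualCoeff p μ h c i|) ∧
    ∀ s, energy p μ h c' ≤ energy p μ h (c - Pi.single i s)

section HaarLike

variable {Ω : Type*} {d : ℕ} {h : Fin (d + 1) → Ω → ℝ}

lemma synth_sub_single (c : Fin (d + 1) → ℝ) (i : Fin (d + 1)) (s : ℝ) (t : Ω) :
    synth h (c - Pi.single i s) t = synth h c t - s * h i t := by
  simp [synth, sub_mul, Finset.sum_sub_distrib, Pi.single_apply, ite_mul]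

lemma synth_smul (s : ℝ) (c : Fin (d + 1) → ℝ) (t : Ω) :
    synth h (s • c) t = s * synth h c t := by
  simp [synth, Finset.mul_sum, mul_assoc]

variable [MeasurableSpace Ω] {μ : Measure Ω} {p : ℝ}

lemma dualCoeff_smul {s : ℝ} (hs : 0 < s) (c : Fin (d + 1) → ℝ) (j : Fin (d + 1)) :
    dualCoeff p μ h (s • c) j = s ^ (p - 1) * dualCoeff p μ h c j := by
  simp_rw [dualCoeff, synth_smul, signedPow_mul hs, mul_assoc, integral_const_mul]

lemma energy_nonneg (c : Fin (d + 1) → ℝ) : 0 ≤ energy p μ h c :=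
  integral_nonneg fun _ => Real.rpow_nonneg (abs_nonneg _) _

lemma weakDualGreedyStep_zero (hp : 1 < p) (ρ : ℝ) : WeakDualGreedyStep p ρ μ h 0 0 := by
  refine ⟨0, 0, by simp, fun j => by simp [dualCoeff, synth, signedPow], fun s => ?_⟩
  have : energy p μ h 0 = 0 := by
    simp [energy, synth, Real.zero_rpow (by linarith : p ≠ 0)]
  rw [this]
  exact energy_nonneg _

lemma energy_smul {s : ℝ} (hs : 0 < s) (c : Fin (d + 1) → ℝ) :
    energy p μ h (s • c) = s ^ p * energy p μ h c := by
  simp_rw [energy, synth_smul, abs_mul, abs_of_pos hs,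
    Real.mul_rpow hs.le (abs_nonneg _), integral_const_mul]

namespace IsHaarLike

lemma abs_le_one (hh : IsHaarLike μ h) (i : Fin (d + 1)) (t : Ω) : |h i t| ≤ 1 := by
  by_cases ht : h i t = 0
  · simp [ht]
  · exact (hh.abs_eq_one i t ht).le

lemma measurable_synth (hh : IsHaarLike μ h) (c : Fin (d + 1) → ℝ) : Measurable (synth h c) :=
  Finset.measurable_fun_sum _ fun j _ => (hh.measurable j).const_mul (c j)

lemma abs_synth_le (hh : IsHaarLike μ h) (c : Fin (d + 1) → ℝ) (t : Ω) :
    |synth h c t| ≤ ∑ j, |c j| := by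
  refine (Finset.abs_sum_le_sum_abs _ _).trans (Finset.sum_le_sum fun j _ => ?_)
  rw [abs_mul]
  exact mul_le_of_le_one_right (abs_nonneg _) (hh.abs_le_one j t)

lemma abs_signedPow_synth_mul_le (hh : IsHaarLike μ h) (hp : 1 < p) (c : Fin (d + 1) → ℝ)
    (j : Fin (d + 1)) (t : Ω) {B : ℝ} (hB : ∑ j, |c j| ≤ B) :
    |signedPow p (synth h c t) * h j t| ≤ B ^ (p - 1) := by
  rw [abs_mul]
  calc |signedPow p (synth h c t)| * |h j t| ≤ |signedPow p (synth h c t)| :=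
        mul_le_of_le_one_right (abs_nonneg _) (hh.abs_le_one j t)
    _ ≤ |synth h c t| ^ (p - 1) := abs_signedPow_le _
    _ ≤ B ^ (p - 1) :=
        Real.rpow_le_rpow (abs_nonneg _) ((hh.abs_synth_le c t).trans hB) (by linarith)

lemma measurable_signedPow_synth (hh : IsHaarLike μ h) (hp : 1 < p) (c : Fin (d + 1) → ℝ) :
    Measurable fun t => signedPow p (synth h c t) :=
  (continuous_signedPow hp).measurable.comp (hh.measurable_synth c)

lemma abs_synth_rpow_le (hh : IsHaarLike μ h) (hp : 1 < p) (c : Fin (d + 1) → ℝ) (t : Ω) :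
    |synth h c t| ^ p ≤ (∑ j, |c j|) ^ p :=
  Real.rpow_le_rpow (abs_nonneg _) (hh.abs_synth_le c t) (by linarith)

variable [IsFiniteMeasure μ]

lemma integrable_signedPow_synth_mul (hh : IsHaarLike μ h) (hp : 1 < p) (c : Fin (d + 1) → ℝ)
    (j : Fin (d + 1)) : Integrable (fun t => signedPow p (synth h c t) * h j t) μ :=
  Integrable.of_bound
    ((hh.measurable_signedPow_synth hp c).mul (hh.measurable j)).aestronglyMeasurable _
    (Filter.Eventually.of_forall fun t => hh.abs_signedPow_synth_mul_le hp c j t le_rfl)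

lemma integrable_abs_synth_rpow (hh : IsHaarLike μ h) (hp : 1 < p) (c : Fin (d + 1) → ℝ) :
    Integrable (fun t => |synth h c t| ^ p) μ := by
  refine Integrable.of_bound ((hh.measurable_synth c).abs.pow_const p).aestronglyMeasurable
    ((∑ j, |c j|) ^ p) (Filter.Eventually.of_forall fun t => ?_)
  rw [Real.norm_of_nonneg (Real.rpow_nonneg (abs_nonneg _) _)]
  exact hh.abs_synth_rpow_le hp c t

lemma energy_le (hh : IsHaarLike μ h) (hp : 1 < p) (c : Fin (d + 1) → ℝ) :
    energy p μ h c ≤ μ.real Set.univ * (∑ j, |c j|) ^ p := by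
  calc energy p μ h c ≤ ∫ _, (∑ j, |c j|) ^ p ∂μ :=
        integral_mono (hh.integrable_abs_synth_rpow hp c) (integrable_const _)
          fun t => hh.abs_synth_rpow_le hp c t
    _ = _ := by simp

lemma continuous_dualCoeff (hh : IsHaarLike μ h) (hp : 1 < p) : Continuous (dualCoeff p μ h) := by
  refine continuous_pi fun j => continuous_iff_continuousAt.2 fun c₀ => ?_
  have hsum : Continuous fun c : Fin (d + 1) → ℝ => ∑ j, |c j| := by fun_prop
  refine continuousAt_of_dominated (bound := fun _ => (∑ j, |c₀ j| + 1) ^ (p - 1))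
    (Filter.Eventually.of_forall fun c =>
      ((hh.measurable_signedPow_synth hp c).mul (hh.measurable j)).aestronglyMeasurable)
    ?_ (integrable_const _) (Filter.Eventually.of_forall fun t => ?_)
  · filter_upwards [hsum.continuousAt.eventually_lt_const (lt_add_one (∑ j, |c₀ j|))] with c hc
    exact Filter.Eventually.of_forall fun t => hh.abs_signedPow_synth_mul_le hp c j t hc.le
  · have : Continuous fun c : Fin (d + 1) → ℝ => synth h c t := by
      unfold synth
      fun_prop
    exact (((continuous_signedPow hp).comp this).mul continuous_const).continuousAt

lemma energy_sub_single_le (hh : IsHaarLike μ h) (hp : 1 < p) (c : Fin (d + 1) → ℝ)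
    (i : Fin (d + 1)) (s : ℝ) :
    energy p μ h (c - Pi.single i s) ≤
      energy p μ h c - p * s * dualCoeff p μ h (c - Pi.single i s) i := by
  have hintegrable := (hh.integrable_signedPow_synth_mul hp (c - Pi.single i s) i).const_mul (p * s)
  have hle := integral_mono ((hh.integrable_abs_synth_rpow hp (c - Pi.single i s)).add hintegrable)
    (hh.integrable_abs_synth_rpow hp c) fun t => by
      have := abs_rpow_add_le hp (synth h (c - Pi.single i s) t) (synth h c t)
      simp only [Pi.add_apply]
      rw [synth_sub_single] at this ⊢
      linarith
  rw [integral_add' (hh.integrable_abs_synth_rpow hp _) hintegrable, integral_const_mul] at hle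
  unfold energy dualCoeff
  linarith

/-- At a minimizer of the energy in the direction `i`, the `i`-th dual coefficient vanishes. -/
lemma dualCoeff_eq_zero_of_energy_le (hh : IsHaarLike μ h) (hp : 1 < p) {c : Fin (d + 1) → ℝ}
    {i : Fin (d + 1)} (hmin : ∀ s, energy p μ h c ≤ energy p μ h (c - Pi.single i s)) :
    dualCoeff p μ h c i = 0 := by
  have hcont : Continuous fun s : ℝ => dualCoeff p μ h (c - Pi.single i s) i :=
    (continuous_apply i).comp ((hh.continuous_dualCoeff hp).comp
      (continuous_const.sub (continuous_single i)))
  have hsign : ∀ s, s * dualCoeff p μ h (c - Pi.single i s) i ≤ 0 := fun s => by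
    have := (hmin s).trans (hh.energy_sub_single_le hp c i s)
    by_contra! hpos
    have := mul_pos (by linarith : 0 < p) hpos
    linarith
  have hlim := hcont.tendsto 0
  simp only [Pi.single_zero, sub_zero] at hlim
  apply le_antisymm
  · refine le_of_tendsto (hlim.mono_left (nhdsWithin_le_nhds (s := Set.Ioi 0))) ?_
    filter_upwards [self_mem_nhdsWithin] with s hs
    exact nonpos_of_mul_nonpos_right (hsign s) hs
  · refine ge_of_tendsto (hlim.mono_left (nhdsWithin_le_nhds (s := Set.Iio 0))) ?_
    filter_upwards [self_mem_nhdsWithin] with s hs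
    exact nonneg_of_mul_nonpos_right (hsign s) hs

/-- If the `i`-th dual coefficient vanishes, the later coefficients control the `i`-th one. -/
lemma abs_le_sum_of_dualCoeff_eq_zero (hh : IsHaarLike μ h) (hp : 1 < p)
    {c : Fin (d + 1) → ℝ} {i : Fin (d + 1)} (hi : dualCoeff p μ h c i = 0) :
    |c i| ≤ ∑ j ∈ Finset.Ioi i, |c j| := by
  by_contra! hlt
  have hconst : ∃ a : ℝ, (i = 0 → a = 0) ∧
      ∀ t, h i t ≠ 0 → ∑ j ∈ Finset.Iio i, c j * h j t = a := by
    choose! b hb using hh.exists_eq_on_support i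
    refine ⟨∑ j ∈ Finset.Iio i, c j * b j, ?_, fun t ht => Finset.sum_congr rfl fun j hj => ?_⟩
    · rintro rfl
      rw [show Finset.Iio (0 : Fin (d + 1)) = ∅ by ext; simp, Finset.sum_empty]
    · rw [hb j (Finset.mem_Iio.1 hj) t ht]
  obtain ⟨a, ha0, ha⟩ := hconst
  have hsplit : ∀ t, h i t ≠ 0 →
      synth h c t = a + c i * h i t + ∑ j ∈ Finset.Ioi i, c j * h j t := fun t ht => by
    rw [← ha t ht, synth, ← Finset.sum_erase_add _ _ (Finset.mem_univ i),
      show Finset.univ.erase i = Finset.Iio i ∪ Finset.Ioi i by ext j; simp [lt_or_lt_iff_ne],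
      Finset.sum_union (by
        rw [Finset.disjoint_left]; intro j; simp only [Finset.mem_Iio, Finset.mem_Ioi]
        exact fun h1 h2 => h1.asymm h2)]
    ring
  have hpos : ∀ t, h i t ≠ 0 →
      0 < c i * ((signedPow p (synth h c t) - signedPow p a) * h i t) := fun t ht => by
    have hrest : |∑ j ∈ Finset.Ioi i, c j * h j t| < |c i * h i t| := by
      rw [abs_mul, hh.abs_eq_one i t ht, mul_one]
      refine lt_of_le_of_lt ((Finset.abs_sum_le_sum_abs _ _).trans
        (Finset.sum_le_sum fun j _ => ?_)) hlt
      rw [abs_mul]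
      exact mul_le_of_le_one_right (abs_nonneg _) (hh.abs_le_one j t)
    have hne : c i * h i t ≠ 0 := abs_pos.1 ((abs_nonneg _).trans_lt hrest)
    rw [← mul_assoc, mul_right_comm]
    rcases hne.lt_or_gt with hneg | hgt
    · rw [abs_of_neg hneg] at hrest
      have := strictMono_signedPow hp (show synth h c t < a by
        rw [hsplit t ht]; linarith [(abs_lt.1 hrest).2])
      exact mul_pos_of_neg_of_neg hneg (by linarith)
    · rw [abs_of_pos hgt] at hrest
      have := strictMono_signedPow hp (show a < synth h c t by
        rw [hsplit t ht]; linarith [(abs_lt.1 hrest).1])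
      exact mul_pos hgt (by linarith)
  have hinti : Integrable (h i) μ := Integrable.of_bound (hh.measurable i).aestronglyMeasurable 1
    (Filter.Eventually.of_forall fun t => hh.abs_le_one i t)
  have hintegrable : Integrable
      (fun t => c i * ((signedPow p (synth h c t) - signedPow p a) * h i t)) μ := by
    simp_rw [sub_mul]
    exact ((hh.integrable_signedPow_synth_mul hp c i).sub (hinti.const_mul _)).const_mul _
  have hzero : ∫ t, c i * ((signedPow p (synth h c t) - signedPow p a) * h i t) ∂μ = 0 := by
    simp_rw [sub_mul]
    rw [integral_const_mul, integral_sub (hh.integrable_signedPow_synth_mul hp c i)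
      (hinti.const_mul _), integral_const_mul, show ∫ t, signedPow p (synth h c t) * h i t ∂μ = 0
      from hi]
    rcases eq_or_ne i 0 with h0 | h0
    · simp [ha0 h0, signedPow]
    · simp [hh.integral_eq_zero i (Fin.pos_iff_ne_zero.2 h0)]
  refine (ne_of_gt ?_) hzero
  rw [integral_pos_iff_support_of_nonneg (fun t => ?_) hintegrable]
  · exact (hh.measure_support_pos i).trans_le (measure_mono fun t ht => (hpos t ht).ne')
  · by_cases ht : h i t = 0
    · simp [ht]
    · exact (hpos t ht).le

lemma eq_zero_of_dualCoeff_eq_zero (hh : IsHaarLike μ h) (hp : 1 < p) {c : Fin (d + 1) → ℝ}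
    (hc : dualCoeff p μ h c = 0) : c = 0 := by
  funext i
  induction i using WellFoundedGT.induction with
  | ind i ih =>
    have := hh.abs_le_sum_of_dualCoeff_eq_zero hp (congrFun hc i)
    rw [Finset.sum_eq_zero fun j hj => by rw [ih j (Finset.mem_Ioi.1 hj)]; simp] at this
    exact abs_nonpos_iff.1 this



lemma exists_energy_drop_on_sphere (hh : IsHaarLike μ h) (hp : 1 < p) {ρ : ℝ} (hρ : 0 < ρ) :
    ∃ κ > 0, ∀ c ∈ Metric.sphere (0 : Fin (d + 1) → ℝ) 1, ∀ i,
      (∀ j, ρ * |dualCoeff p μ h c j| ≤ |dualCoeff p μ h c i|) →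
      ∃ s, energy p μ h (c - Pi.single i s) ≤ energy p μ h c - κ := by
  have hcont := hh.continuous_dualCoeff hp
  obtain ⟨δ, hδ, hmin⟩ : ∃ δ > 0, ∀ c ∈ Metric.sphere (0 : Fin (d + 1) → ℝ) 1,
      δ ≤ ‖dualCoeff p μ h c‖ := by
    obtain ⟨c₀, hc₀, hmin⟩ := (isCompact_sphere (0 : Fin (d + 1) → ℝ) 1).exists_isMinOn
      (NormedSpace.sphere_nonempty.2 zero_le_one) hcont.norm.continuousOn
    refine ⟨_, norm_pos_iff.2 fun h0 => ?_, fun c hc => hmin hc⟩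
    simp [hh.eq_zero_of_dualCoeff_eq_zero hp h0] at hc₀
  obtain ⟨η, hη, huc⟩ := Metric.uniformContinuousOn_iff.1
    ((isCompact_closedBall (0 : Fin (d + 1) → ℝ) 2).uniformContinuousOn_of_continuous
      hcont.continuousOn) (ρ * δ / 2) (by positivity)
  obtain ⟨τ, hτ, hτη, hτ1⟩ : ∃ τ > 0, τ < η ∧ τ ≤ 1 :=
    ⟨min (η / 2) 1, by positivity, (min_le_left _ _).trans_lt (half_lt_self hη), min_le_right _ _⟩
  refine ⟨p * (τ * (ρ * δ / 2)), by positivity, fun c hc i hi => ?_⟩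
  have hc1 : ‖c‖ = 1 := by simpa using hc
  have hlow : ρ * δ ≤ |dualCoeff p μ h c i| := by
    have : ‖dualCoeff p μ h c‖ ≤ |dualCoeff p μ h c i| / ρ :=
      (pi_norm_le_iff_of_nonneg (by positivity)).2 fun j => by
        rw [le_div_iff₀ hρ, mul_comm]
        exact hi j
    rw [le_div_iff₀ hρ] at this
    calc ρ * δ ≤ ρ * ‖dualCoeff p μ h c‖ := by gcongr; exact hmin c hc
      _ ≤ _ := by linarith
  have hclose : ∀ s, |s| = τ →
      |dualCoeff p μ h (c - Pi.single i s) i - dualCoeff p μ h c i| < ρ * δ / 2 := fun s hs => by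
    have hnorm : ‖(Pi.single i s : Fin (d + 1) → ℝ)‖ = τ := by rw [Pi.norm_single, ← hs]; rfl
    have hmem : c ∈ Metric.closedBall 0 2 := by
      rw [mem_closedBall_zero_iff]
      linarith
    have hmem' : c - Pi.single i s ∈ Metric.closedBall 0 2 := by
      rw [mem_closedBall_zero_iff]
      linarith [norm_sub_le c (Pi.single i s)]
    have hdist : dist (c - Pi.single i s) c < η := by
      rwa [dist_eq_norm, sub_sub_cancel_left, norm_neg, hnorm]
    have hlt := huc _ hmem' _ hmem hdist
    exact (dist_pi_lt_iff (by positivity)).1 hlt i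
  have key : ∃ s, τ * (ρ * δ / 2) ≤ s * dualCoeff p μ h (c - Pi.single i s) i := by
    rcases le_total 0 (dualCoeff p μ h c i) with hsgn | hsgn
    · refine ⟨τ, mul_le_mul_of_nonneg_left ?_ hτ.le⟩
      rw [abs_of_nonneg hsgn] at hlow
      linarith [(abs_lt.1 (hclose τ (abs_of_pos hτ))).1]
    · refine ⟨-τ, ?_⟩
      rw [neg_mul_comm]
      refine mul_le_mul_of_nonneg_left ?_ hτ.le
      rw [abs_of_nonpos hsgn] at hlow
      linarith [(abs_lt.1 (hclose (-τ) (by rw [abs_neg, abs_of_pos hτ]))).2]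
  obtain ⟨s, hs⟩ := key
  refine ⟨s, (hh.energy_sub_single_le hp c i s).trans ?_⟩
  have := mul_le_mul_of_nonneg_left hs (by linarith : 0 ≤ p)
  linarith

/-- A step of the weak dual greedy algorithm lowers the energy by a fixed multiple of the `p`-th
power of each coefficient. -/
lemma exists_energy_drop (hh : IsHaarLike μ h) (hp : 1 < p) {ρ : ℝ} (hρ : 0 < ρ) :
    ∃ κ > 0, ∀ c c', WeakDualGreedyStep p ρ μ h c c' → ∀ a,
      energy p μ h c' ≤ energy p μ h c - κ * |c a| ^ p := by
  obtain ⟨κ, hκ, hdrop⟩ := hh.exists_energy_drop_on_sphere hp hρ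
  refine ⟨κ, hκ, ?_⟩
  rintro c c' ⟨i, t, -, hgreedy, hmin⟩ a
  have hp0 : p ≠ 0 := by linarith
  rcases eq_or_ne c 0 with rfl | hc
  · simpa [Real.zero_rpow hp0] using hmin 0
  have hr : 0 < ‖c‖ := norm_pos_iff.2 hc
  have hle : |c a| ≤ ‖c‖ := norm_le_pi_norm c a
  generalize hr' : ‖c‖ = r at hr hle
  have hce : c = r • (r⁻¹ • c) := (smul_inv_smul₀ hr.ne' c).symm
  have he : ‖r⁻¹ • c‖ = 1 := by
    rw [norm_smul, hr', norm_inv, Real.norm_of_nonneg hr.le, inv_mul_cancel₀ hr.ne']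
  generalize r⁻¹ • c = e at hce he
  subst hce
  obtain ⟨s, hs⟩ := hdrop e (by simpa using he) i fun j => by
    have := hgreedy j
    rw [dualCoeff_smul hr, dualCoeff_smul hr, abs_mul, abs_mul,
      abs_of_pos (Real.rpow_pos_of_pos hr _), mul_left_comm] at this
    exact le_of_mul_le_mul_left this (Real.rpow_pos_of_pos hr _)
  have hsub : r • e - Pi.single i (r * s) = r • (e - Pi.single i s) := by
    rw [smul_sub, ← Pi.single_smul, smul_eq_mul]
  calc energy p μ h c' ≤ r ^ p * energy p μ h (e - Pi.single i s) := by
        rw [← energy_smul hr, ← hsub]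
        exact hmin _
    _ ≤ r ^ p * (energy p μ h e - κ) := by gcongr
    _ = energy p μ h (r • e) - κ * r ^ p := by rw [energy_smul hr]; ring
    _ ≤ _ := by gcongr

/-- A step changes a single coefficient, to a value controlled by the later coefficients. -/
lemma exists_abs_le_sum_of_step (hh : IsHaarLike μ h) (hp : 1 < p) {ρ : ℝ}
    {c c' : Fin (d + 1) → ℝ} (hstep : WeakDualGreedyStep p ρ μ h c c') :
    ∃ i, (∀ j ≠ i, c' j = c j) ∧ |c' i| ≤ ∑ j ∈ Finset.Ioi i, |c' j| := by
  obtain ⟨i, t, rfl, -, hmin⟩ := hstep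
  refine ⟨i, fun j hj => by simp [hj], hh.abs_le_sum_of_dualCoeff_eq_zero hp
    (hh.dualCoeff_eq_zero_of_energy_le hp fun s => ?_)⟩
  rw [sub_sub, ← Pi.single_add]
  exact hmin _

end IsHaarLike

/-- Weights which decay geometrically along the family. -/
def levelWeight {d : ℕ} (j : Fin (d + 1)) : ℝ := (d + 1 : ℝ) ^ (d - (j : ℕ))

lemma one_le_levelWeight (j : Fin (d + 1)) : 1 ≤ levelWeight j :=
  one_le_pow₀ (by linarith [(Nat.cast_nonneg d : (0 : ℝ) ≤ d)])

lemma sum_levelWeight_le (i : Fin (d + 1)) :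
    ∑ j ∈ Finset.Ioi i, levelWeight j ≤ levelWeight i := by
  rcases (Finset.Ioi i).eq_empty_or_nonempty with hempty | ⟨k, hk⟩
  · rw [hempty, Finset.sum_empty]
    exact zero_le_one.trans (one_le_levelWeight i)
  have hd : (1 : ℝ) ≤ d + 1 := by linarith [(Nat.cast_nonneg d : (0 : ℝ) ≤ d)]
  have hid : (i : ℕ) < d := by
    have : i < k := Finset.mem_Ioi.1 hk
    omega
  calc ∑ j ∈ Finset.Ioi i, levelWeight j
      ≤ (Finset.Ioi i).card • (d + 1 : ℝ) ^ (d - (i : ℕ) - 1) :=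
        Finset.sum_le_card_nsmul _ _ _ fun j hj => pow_le_pow_right₀ hd (by
          have : i < j := Finset.mem_Ioi.1 hj
          omega)
    _ ≤ (d + 1 : ℝ) * (d + 1 : ℝ) ^ (d - (i : ℕ) - 1) := by
        rw [nsmul_eq_mul]
        gcongr
        have := Finset.card_le_univ (Finset.Ioi i)
        rw [Fintype.card_fin] at this
        exact_mod_cast this
    _ = levelWeight i := by
        rw [← pow_succ', levelWeight]
        congr 1
        omega

/-- The coefficients with index at least `a` are at most `s` in the weighted sense. -/
def TailBound (a : ℕ) (s : ℝ) (c : Fin (d + 1) → ℝ) : Prop :=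
  ∀ j : Fin (d + 1), a ≤ j → |c j| ≤ levelWeight j * s

lemma TailBound.of_eq_off {a : ℕ} {s : ℝ} (hs : 0 ≤ s) {c c' : Fin (d + 1) → ℝ} {i : Fin (d + 1)}
    (heq : ∀ j ≠ i, c' j = c j) (hle : |c' i| ≤ ∑ j ∈ Finset.Ioi i, |c' j|)
    (hc : ∀ j ≠ i, a ≤ j → |c j| ≤ levelWeight j * s) : TailBound a s c' := by
  intro j hj
  rcases eq_or_ne j i with rfl | hne
  · calc |c' j| ≤ ∑ k ∈ Finset.Ioi j, |c' k| := hle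
      _ ≤ ∑ k ∈ Finset.Ioi j, levelWeight k * s := Finset.sum_le_sum fun k hk => by
          have hlt : j < k := Finset.mem_Ioi.1 hk
          rw [heq k hlt.ne']
          exact hc k hlt.ne' (hj.trans hlt.le)
      _ ≤ levelWeight j * s := by
          rw [← Finset.sum_mul]
          gcongr
          exact sum_levelWeight_le j
  · rw [heq j hne]
    exact hc j hne hj

namespace IsHaarLike

variable [IsFiniteMeasure μ] {ρ : ℝ}

lemma tailBound_of_step (hh : IsHaarLike μ h) (hp : 1 < p) {a : ℕ} {s : ℝ} (hs : 0 ≤ s)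
    {c c' : Fin (d + 1) → ℝ} (hstep : WeakDualGreedyStep p ρ μ h c c') (hc : TailBound a s c) :
    TailBound a s c' := by
  obtain ⟨i, heq, hle⟩ := hh.exists_abs_le_sum_of_step hp hstep
  exact TailBound.of_eq_off hs heq hle fun j _ hj => hc j hj

lemma tailBound_of_step_of_ne (hh : IsHaarLike μ h) (hp : 1 < p) {a : Fin (d + 1)} {s : ℝ}
    (hs : 0 ≤ s) {c c' : Fin (d + 1) → ℝ} (hstep : WeakDualGreedyStep p ρ μ h c c')
    (hc : TailBound (a + 1) s c) (hne : c' a ≠ c a) : TailBound a s c' := by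
  obtain ⟨i, heq, hle⟩ := hh.exists_abs_le_sum_of_step hp hstep
  obtain rfl : a = i := by_contra fun h => hne (heq a h)
  exact TailBound.of_eq_off hs heq hle fun j hj hj' =>
    hc j (Nat.succ_le_of_lt (lt_of_le_of_ne hj' fun h => hj (Fin.ext h.symm)))

lemma tailBound_of_le (hh : IsHaarLike μ h) (hp : 1 < p) {a : ℕ} {s : ℝ} (hs : 0 ≤ s)
    {c : ℕ → Fin (d + 1) → ℝ} (hstep : ∀ n, WeakDualGreedyStep p ρ μ h (c n) (c (n + 1)))
    {k n : ℕ} (hkn : k ≤ n) (hc : TailBound a s (c k)) : TailBound a s (c n) :=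
  Nat.le_induction hc (fun l _ hl => hh.tailBound_of_step hp hs (hstep l) hl) n hkn

/-- A weighted bound on the coefficients from index `a` on spreads to all coefficients within a
number of steps which does not depend on the bound. -/
lemma exists_tailBound_zero (hh : IsHaarLike μ h) (hp : 1 < p) (hρ : 0 < ρ) (a : ℕ)
    (ha : a ≤ d + 1) :
    ∃ N : ℕ, ∀ c : ℕ → Fin (d + 1) → ℝ,
      (∀ n, WeakDualGreedyStep p ρ μ h (c n) (c (n + 1))) →
      ∀ s, 0 ≤ s → TailBound a s (c 0) → TailBound 0 s (c N) := by
  induction a with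
  | zero => exact ⟨0, fun c _ s _ hc => hc⟩
  | succ a ih =>
    obtain ⟨N, hN⟩ := ih (by omega)
    obtain ⟨κ, hκ, hdrop⟩ := hh.exists_energy_drop hp hρ
    obtain ⟨L, hL⟩ := exists_nat_gt (μ.real Set.univ * (∑ j : Fin (d + 1), levelWeight j) ^ p / κ)
    rw [div_lt_iff₀ hκ] at hL
    refine ⟨N + L + N, fun c hstep s hs hc => ?_⟩
    have spread : ∀ n ≤ N + L, TailBound a s (c n) → TailBound 0 s (c (N + L + N)) :=
      fun n hn hcn => hh.tailBound_of_le hp hs hstep (by omega : n + N ≤ N + L + N)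
        (hN (fun k => c (n + k)) (fun k => hstep (n + k)) s hs hcn)
    let b : Fin (d + 1) := ⟨a, by omega⟩
    by_cases hchange : ∃ n < N + L, c (n + 1) b ≠ c n b
    · obtain ⟨n, hn, hne⟩ := hchange
      exact spread (n + 1) hn (hh.tailBound_of_step_of_ne (a := b) hp hs (hstep n)
        (hh.tailBound_of_le hp hs hstep n.zero_le hc) hne)
    push Not at hchange
    have hfix : ∀ n ≤ N + L, c n b = c 0 b := fun n => by
      induction n with
      | zero => exact fun _ => rfl
      | succ n ihn => exact fun hn => (hchange n hn).trans (ihn (by omega))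
    have hw : 0 < levelWeight b := zero_lt_one.trans_le (one_le_levelWeight b)
    have htail : ∀ s' ≥ s, |c 0 b| ≤ levelWeight b * s' → TailBound a s' (c 0) :=
      fun s' hs' hb j hj => by
        rcases eq_or_lt_of_le hj with hj | hj
        · rwa [show j = b from Fin.ext hj.symm]
        · refine (hc j hj).trans ?_
          gcongr
          exact zero_le_one.trans (one_le_levelWeight j)
    rcases le_or_gt |c 0 b| (levelWeight b * s) with hb | hb
    · exact spread 0 (Nat.zero_le _) (htail s le_rfl hb)
    exfalso
    have hbpos : 0 < |c 0 b| := (by positivity : 0 ≤ levelWeight b * s).trans_lt hb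
    set s' := |c 0 b| / levelWeight b with hs'
    have hss' : s ≤ s' := by
      rw [hs', le_div_iff₀ hw, mul_comm]
      exact hb.le
    have hall := hN c hstep s' (hs.trans hss') (htail s' hss' (mul_div_cancel₀ _ hw.ne').ge)
    have hs'le : s' ≤ |c 0 b| := div_le_self hbpos.le (one_le_levelWeight b)
    have hsum : ∑ j, |c N j| ≤ (∑ j : Fin (d + 1), levelWeight j) * |c 0 b| := by
      rw [Finset.sum_mul]
      refine Finset.sum_le_sum fun j _ => (hall j (Nat.zero_le _)).trans ?_
      gcongr
      exact zero_le_one.trans (one_le_levelWeight j)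
    have hstart : energy p μ h (c N) ≤
        μ.real Set.univ * (∑ j : Fin (d + 1), levelWeight j) ^ p * |c 0 b| ^ p := by
      refine (hh.energy_le hp (c N)).trans ?_
      rw [mul_assoc, ← Real.mul_rpow (Finset.sum_nonneg fun j _ =>
        zero_le_one.trans (one_le_levelWeight j)) (abs_nonneg _)]
      gcongr
    have hdec : ∀ l ≤ L,
        energy p μ h (c (N + l)) ≤ energy p μ h (c N) - l * (κ * |c 0 b| ^ p) := fun l => by
      induction l with
      | zero => simp
      | succ l ihl =>
        intro hl
        have h1 := hdrop _ _ (hstep (N + l)) b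
        rw [hfix (N + l) (by omega)] at h1
        have h2 := ihl (by omega)
        push_cast
        rw [← add_assoc]
        linarith
    have hnonneg : 0 ≤ energy p μ h (c (N + L)) := energy_nonneg _
    have := mul_lt_mul_of_pos_right hL (Real.rpow_pos_of_pos hbpos p)
    linarith [hdec L le_rfl]

/-- The weak dual greedy algorithm for a Haar-like family terminates after a bounded number of
steps. -/
theorem exists_forall_eq_zero (hh : IsHaarLike μ h) (hp : 1 < p) (hρ : 0 < ρ) :
    ∃ N : ℕ, 0 < N ∧ ∀ c : ℕ → Fin (d + 1) → ℝ,
      (∀ n, WeakDualGreedyStep p ρ μ h (c n) (c (n + 1))) → c N = 0 := by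
  obtain ⟨N, hN⟩ := hh.exists_tailBound_zero hp hρ (d + 1) le_rfl
  refine ⟨N + 1, N.succ_pos, fun c hstep => funext fun j => ?_⟩
  have := hh.tailBound_of_step hp le_rfl (hstep N)
    (hN c hstep 0 le_rfl fun j hj => absurd j.2 (not_lt.2 hj)) j (Nat.zero_le _)
  rw [mul_zero] at this
  exact abs_nonpos_iff.1 this

end IsHaarLike

end HaarLike

section Haar

lemma haarFn_zero (t : ℝ) : haarFn 0 t = Set.indicator (Set.Ico (0 : ℝ) 1) 1 t := by
  simp [haarFn]

lemma haarFn_of_ne_zero {i : ℕ} (hi : i ≠ 0) (t : ℝ) :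
    haarFn i t =
      Set.indicator (Set.Ico (((i - 2 ^ Nat.log 2 i : ℕ) : ℝ) / 2 ^ Nat.log 2 i)
        ((2 * ((i - 2 ^ Nat.log 2 i : ℕ) : ℝ) + 1) / 2 ^ (Nat.log 2 i + 1))) 1 t -
      Set.indicator (Set.Ico ((2 * ((i - 2 ^ Nat.log 2 i : ℕ) : ℝ) + 1) / 2 ^ (Nat.log 2 i + 1))
        ((((i - 2 ^ Nat.log 2 i : ℕ) : ℝ) + 1) / 2 ^ Nat.log 2 i)) 1 t := by
  simp [haarFn, hi]

lemma mem_Ico_div_two_pow_iff (n : ℕ) (k : ℤ) (a b t : ℝ) (ha : a = k / 2 ^ n)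
    (hb : b = (k + 1) / 2 ^ n) : t ∈ Set.Ico a b ↔ ⌊(2 : ℝ) ^ n * t⌋ = k := by
  rw [Int.floor_eq_iff, Set.mem_Ico, ha, hb, div_le_iff₀' (by positivity),
    lt_div_iff₀' (by positivity)]

lemma haarFn_eq_ite {i : ℕ} (hi : i ≠ 0) (t : ℝ) :
    haarFn i t =
      if ⌊(2 : ℝ) ^ (Nat.log 2 i + 1) * t⌋ = 2 * (i - 2 ^ Nat.log 2 i : ℕ) then 1
      else if ⌊(2 : ℝ) ^ (Nat.log 2 i + 1) * t⌋ = 2 * (i - 2 ^ Nat.log 2 i : ℕ) + 1 then -1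
      else 0 := by
  rw [haarFn_of_ne_zero hi]
  generalize i - 2 ^ Nat.log 2 i = k
  generalize Nat.log 2 i = n
  have h1 := mem_Ico_div_two_pow_iff (n + 1) (2 * k) ((k : ℝ) / 2 ^ n)
    ((2 * (k : ℝ) + 1) / 2 ^ (n + 1)) t
    (by push_cast; rw [pow_succ]; field_simp) (by push_cast; rfl)
  have h2 := mem_Ico_div_two_pow_iff (n + 1) (2 * k + 1) ((2 * (k : ℝ) + 1) / 2 ^ (n + 1))
    (((k : ℝ) + 1) / 2 ^ n) t
    (by push_cast; rfl) (by push_cast; rw [pow_succ]; field_simp; ring)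
  simp only [Set.indicator_apply, h1, h2, Pi.one_apply]
  split_ifs <;> first | omega | norm_num

lemma floor_two_pow_mul_of_le {l n : ℕ} (hln : l ≤ n) (t : ℝ) :
    ⌊(2 : ℝ) ^ l * t⌋ = ⌊(2 : ℝ) ^ n * t⌋ / 2 ^ (n - l) := by
  have := Int.floor_div_natCast ((2 : ℝ) ^ n * t) (2 ^ (n - l))
  push_cast at this
  rw [← this]
  congr 1
  rw [eq_div_iff (by positivity), mul_right_comm, ← pow_add, Nat.add_sub_cancel' hln]

lemma floor_eq_of_haarFn_ne_zero {i : ℕ} (hi : i ≠ 0) {t : ℝ} (ht : haarFn i t ≠ 0) :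
    ⌊(2 : ℝ) ^ Nat.log 2 i * t⌋ = (i - 2 ^ Nat.log 2 i : ℕ) := by
  rw [haarFn_eq_ite hi] at ht
  rw [floor_two_pow_mul_of_le (Nat.le_add_right _ 1), Nat.add_sub_cancel_left, pow_one]
  split_ifs at ht with h1 h2
  · rw [h1]
    omega
  · rw [h2]
    omega
  · exact absurd rfl ht

lemma sub_two_pow_log_lt {i : ℕ} : i - 2 ^ Nat.log 2 i < 2 ^ Nat.log 2 i := by
  have := Nat.lt_pow_succ_log_self (b := 2) one_lt_two i
  rw [Nat.succ_eq_add_one, pow_succ] at this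
  have := Nat.two_pow_pos (Nat.log 2 i)
  omega

lemma measurable_haarFn (i : ℕ) : Measurable (haarFn i) := by
  rcases eq_or_ne i 0 with rfl | hi
  · rw [funext haarFn_zero]
    exact measurable_one.indicator measurableSet_Ico
  · rw [funext (haarFn_of_ne_zero hi)]
    exact (measurable_one.indicator measurableSet_Ico).sub
      (measurable_one.indicator measurableSet_Ico)

lemma abs_haarFn_of_ne_zero {i : ℕ} {t : ℝ} (ht : haarFn i t ≠ 0) : |haarFn i t| = 1 := by
  rcases eq_or_ne i 0 with rfl | hi
  · rw [haarFn_zero, Set.indicator_apply] at ht ⊢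
    split_ifs at ht ⊢ <;> simp_all
  · rw [haarFn_eq_ite hi] at ht ⊢
    split_ifs at ht ⊢ <;> simp_all

lemma mem_Ico_of_haarFn_ne_zero {i : ℕ} {t : ℝ} (ht : haarFn i t ≠ 0) : t ∈ Set.Ico (0 : ℝ) 1 := by
  rcases eq_or_ne i 0 with rfl | hi
  · rw [haarFn_zero] at ht
    exact Set.mem_of_indicator_ne_zero ht
  · have hfloor := floor_eq_of_haarFn_ne_zero hi ht
    have hlt := sub_two_pow_log_lt (i := i)
    rw [Int.floor_eq_iff] at hfloor
    generalize i - 2 ^ Nat.log 2 i = k at *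
    generalize Nat.log 2 i = n at *
    have hpos : (0 : ℝ) < 2 ^ n := by positivity
    have hk : (k : ℝ) + 1 ≤ 2 ^ n := by exact_mod_cast hlt
    push_cast at hfloor
    have hk0 : (0 : ℝ) ≤ k := k.cast_nonneg
    constructor
    · exact nonneg_of_mul_nonneg_right (hk0.trans hfloor.1) hpos
    · by_contra! h1
      nlinarith [hfloor.2]

lemma exists_haarFn_eq_on_support {i j : ℕ} (hji : j < i) :
    ∃ b, ∀ t, haarFn i t ≠ 0 → haarFn j t = b := by
  have hi : i ≠ 0 := by omega
  rcases eq_or_ne j 0 with rfl | hj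
  · refine ⟨1, fun t ht => ?_⟩
    rw [haarFn_zero, Set.indicator_of_mem (mem_Ico_of_haarFn_ne_zero ht), Pi.one_apply]
  rcases (Nat.log_mono_right (b := 2) hji.le).lt_or_eq with hlog | hlog
  · exact ⟨_, fun t ht => by
      rw [haarFn_eq_ite hj, floor_two_pow_mul_of_le (Nat.succ_le_of_lt hlog),
        floor_eq_of_haarFn_ne_zero hi ht]⟩
  · refine ⟨0, fun t ht => by_contra fun hne => ?_⟩
    have h1 := floor_eq_of_haarFn_ne_zero hi ht
    have h2 := floor_eq_of_haarFn_ne_zero hj hne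
    have h3 := Nat.pow_log_le_self 2 hi
    have h4 := Nat.pow_log_le_self 2 hj
    rw [hlog] at h2 h4
    omega

lemma integral_haarFn_eq_zero {i : ℕ} (hi : i ≠ 0) :
    ∫ t in Set.Ico (0 : ℝ) 1, haarFn i t = 0 := by
  rw [setIntegral_eq_integral_of_forall_compl_eq_zero fun t ht =>
    by_contra fun hne => ht (mem_Ico_of_haarFn_ne_zero hne)]
  simp_rw [haarFn_of_ne_zero hi]
  generalize i - 2 ^ Nat.log 2 i = k
  generalize Nat.log 2 i = n
  have hintegrable : ∀ a b : ℝ, Integrable (Set.indicator (Set.Ico a b) (1 : ℝ → ℝ)) := fun a b =>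
    (integrable_indicator_iff measurableSet_Ico).2 (integrableOn_const (by simp))
  rw [integral_sub (hintegrable _ _) (hintegrable _ _), integral_indicator_one measurableSet_Ico,
    integral_indicator_one measurableSet_Ico, Real.volume_real_Ico_of_le,
    Real.volume_real_Ico_of_le]
  · rw [pow_succ]
    field_simp
    ring
  all_goals
    rw [pow_succ, div_le_div_iff₀ (by positivity) (by positivity)]
    nlinarith [show (0 : ℝ) < 2 ^ n by positivity]

lemma measure_support_haarFn_pos (i : ℕ) :
    0 < volume.restrict (Set.Ico (0 : ℝ) 1) (Function.support (haarFn i)) := by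
  rw [Measure.restrict_apply (measurableSet_support (measurable_haarFn i)),
    Set.inter_eq_left.2 (show Function.support (haarFn i) ⊆ _ from
      fun t ht => mem_Ico_of_haarFn_ne_zero ht)]
  rcases eq_or_ne i 0 with rfl | hi
  · refine (show 0 < volume (Set.Ico (0 : ℝ) 1) by simp).trans_le (measure_mono fun t ht => ?_)
    rw [Function.mem_support, haarFn_zero, Set.indicator_of_mem ht]
    exact one_ne_zero
  · have hsub : Set.Ico (((2 * (i - 2 ^ Nat.log 2 i : ℕ) : ℤ) : ℝ) / 2 ^ (Nat.log 2 i + 1))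
        ((((2 * (i - 2 ^ Nat.log 2 i : ℕ) : ℤ) : ℝ) + 1) / 2 ^ (Nat.log 2 i + 1)) ⊆
        Function.support (haarFn i) := fun t ht => by
      rw [Function.mem_support, haarFn_eq_ite hi,
        if_pos ((mem_Ico_div_two_pow_iff _ _ _ _ t rfl rfl).1 ht)]
      exact one_ne_zero
    refine lt_of_lt_of_le ?_ (measure_mono hsub)
    rw [Real.volume_Ico, ENNReal.ofReal_pos, sub_pos]
    gcongr
    exact lt_add_one _

lemma isHaarLike_haarFn (m : ℕ) :
    IsHaarLike (volume.restrict (Set.Ico (0 : ℝ) 1)) fun j : Fin (m + 1) => haarFn j where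
  measurable i := measurable_haarFn i
  exists_eq_on_support i j hji := exists_haarFn_eq_on_support hji
  abs_eq_one i t ht := abs_haarFn_of_ne_zero ht
  integral_eq_zero i hi := integral_haarFn_eq_zero (by
    have : (0 : ℕ) < i := hi
    omega)
  measure_support_pos i := measure_support_haarFn_pos i

lemma pnorm_eq_integral {p : ℝ} (hp : 0 < p) {f : ℝ → ℝ} (hf : Measurable f) {B : ℝ}
    (hB : ∀ t, |f t| ≤ B) :
    pnorm p f = (∫ t in Set.Ico (0 : ℝ) 1, |f t| ^ p) ^ p⁻¹ := by
  have hmem : MemLp f (ENNReal.ofReal p) (volume.restrict (Set.Ico (0 : ℝ) 1)) :=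
    MemLp.of_bound hf.aestronglyMeasurable B (Filter.Eventually.of_forall hB)
  rw [pnorm, hmem.eLpNorm_eq_integral_rpow_norm (by simpa using hp) ENNReal.ofReal_ne_top,
    ENNReal.toReal_ofReal hp.le, ENNReal.toReal_ofReal (Real.rpow_nonneg
      (integral_nonneg fun t => Real.rpow_nonneg (norm_nonneg _) _) _)]
  simp only [Real.norm_eq_abs]

lemma pnorm_haarFn_pos {p : ℝ} (hp : 0 < p) (i : ℕ) : 0 < pnorm p (haarFn i) := by
  have hle : ∀ t, |haarFn i t| ≤ 1 := fun t => by
    by_cases ht : haarFn i t = 0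
    · simp [ht]
    · exact (abs_haarFn_of_ne_zero ht).le
  rw [pnorm_eq_integral hp (measurable_haarFn i) hle]
  refine Real.rpow_pos_of_pos ?_ _
  rw [integral_pos_iff_support_of_nonneg fun t => Real.rpow_nonneg (abs_nonneg _) _]
  · refine (measure_support_haarFn_pos i).trans_le (measure_mono fun t ht => ?_)
    exact (Real.rpow_pos_of_pos (abs_pos.2 ht) p).ne'
  · refine Integrable.of_bound ((measurable_haarFn i).abs.pow_const p).aestronglyMeasurable 1
      (Filter.Eventually.of_forall fun t => ?_)
    rw [Real.norm_of_nonneg (Real.rpow_nonneg (abs_nonneg _) _)]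
    exact Real.rpow_le_one (abs_nonneg _) (hle t) hp.le

lemma pnorm_synth {p : ℝ} (hp : 1 < p) {m : ℕ} (c : Fin (m + 1) → ℝ) :
    pnorm p (synth (fun j : Fin (m + 1) => haarFn j) c) =
      energy p (volume.restrict (Set.Ico (0 : ℝ) 1)) (fun j : Fin (m + 1) => haarFn j) c ^ p⁻¹ :=
  pnorm_eq_integral (by linarith) ((isHaarLike_haarFn m).measurable_synth c)
    ((isHaarLike_haarFn m).abs_synth_le c)

lemma normingF_haarFnP {p : ℝ} (y : ℝ → ℝ) (j : ℕ) :
    normingF p y (haarFnP p j) =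
      pnorm p y ^ (1 - p) *
        ((∫ t in Set.Ico (0 : ℝ) 1, signedPow p (y t) * haarFn j t) / pnorm p (haarFn j)) := by
  rw [normingF, ← integral_div]
  simp_rw [haarFnP, mul_div_assoc]
  rfl

lemma eq_zero_of_pnorm_synth_eq_zero {p : ℝ} (hp : 1 < p) {m : ℕ} {c : Fin (m + 1) → ℝ}
    (hc : pnorm p (synth (fun j : Fin (m + 1) => haarFn j) c) = 0) : c = 0 := by
  have hh := isHaarLike_haarFn m
  have hnonneg : ∀ t, 0 ≤ |synth (fun j : Fin (m + 1) => haarFn j) c t| ^ p :=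
    fun t => Real.rpow_nonneg (abs_nonneg _) _
  rw [pnorm_synth hp, Real.rpow_eq_zero (energy_nonneg _) (by positivity), energy,
    integral_eq_zero_iff_of_nonneg hnonneg (hh.integrable_abs_synth_rpow hp c)] at hc
  refine hh.eq_zero_of_dualCoeff_eq_zero hp (funext fun j => integral_eq_zero_of_ae ?_)
  filter_upwards [hc] with t ht
  have h0 : synth (fun j : Fin (m + 1) => haarFn j) c t = 0 := by
    simpa using (Real.rpow_eq_zero (abs_nonneg _) (by linarith)).1 ht
  simp [h0, signedPow]

/-- Along a step of the dual greedy algorithm for the normalized Haar system, the coefficients with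
respect to the unnormalized system perform a step of the weak algorithm. -/
lemma weakDualGreedyStep_of_haarFnP {p ρ : ℝ} (hp : 1 < p) {m : ℕ}
    (hρ : ∀ i j : Fin (m + 1), ρ ≤ pnorm p (haarFn i) / pnorm p (haarFn j))
    {c : Fin (m + 1) → ℝ} (hc : c ≠ 0) {i : Fin (m + 1)} {lam : ℝ}
    (hgreedy : ∀ j ≤ m,
      |normingF p (synth (fun j : Fin (m + 1) => haarFn j) c) (haarFnP p j)| ≤
        |normingF p (synth (fun j : Fin (m + 1) => haarFn j) c) (haarFnP p i)|)
    (hmin : ∀ t : ℝ,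
      pnorm p (fun s => synth (fun j : Fin (m + 1) => haarFn j) c s - lam * haarFnP p i s) ≤
        pnorm p (fun s => synth (fun j : Fin (m + 1) => haarFn j) c s - t * haarFnP p i s)) :
    WeakDualGreedyStep p ρ (volume.restrict (Set.Ico (0 : ℝ) 1))
      (fun j : Fin (m + 1) => haarFn j) c (c - Pi.single i (lam / pnorm p (haarFn i))) := by
  have hp0 : 0 < p := by linarith
  have hw := fun j => pnorm_haarFn_pos hp0 j
  refine ⟨i, _, rfl, fun j => ?_, fun s => ?_⟩
  · have hpos : 0 < pnorm p (synth (fun j : Fin (m + 1) => haarFn j) c) ^ (1 - p) :=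
      Real.rpow_pos_of_pos (lt_of_le_of_ne ENNReal.toReal_nonneg
        fun h0 => hc (eq_zero_of_pnorm_synth_eq_zero hp h0.symm)) _
    have hj := hgreedy j (Nat.lt_succ_iff.1 j.2)
    rw [normingF_haarFnP, normingF_haarFnP, abs_mul, abs_mul, abs_of_pos hpos] at hj
    have hj := le_of_mul_le_mul_left hj hpos
    rw [abs_div, abs_div, abs_of_pos (hw i), abs_of_pos (hw j), le_div_iff₀ (hw i),
      div_mul_eq_mul_div, mul_div_assoc, mul_comm] at hj
    exact (mul_le_mul_of_nonneg_right (hρ i j) (abs_nonneg _)).trans hj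
  · have heq : ∀ t : ℝ,
        (fun s => synth (fun j : Fin (m + 1) => haarFn j) c s - t * haarFnP p i s) =
          synth (fun j : Fin (m + 1) => haarFn j)
            (c - Pi.single i (t / pnorm p (haarFn i))) := fun t => by
      funext s
      rw [synth_sub_single, haarFnP]
      ring
    have hle := hmin (s * pnorm p (haarFn i))
    rw [heq, heq, mul_div_cancel_right₀ _ (hw i).ne', pnorm_synth hp, pnorm_synth hp,
      Real.rpow_le_rpow_iff (energy_nonneg _) (energy_nonneg _) (by positivity)] at hle
    exact hle

lemma eq_zero_of_synth_eq_zero {m : ℕ} {c : Fin (m + 1) → ℝ}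
    (hc : synth (fun j : Fin (m + 1) => haarFn j) c = 0) : c = 0 := by
  refine eq_zero_of_pnorm_synth_eq_zero (p := 2) one_lt_two ?_
  rw [hc, pnorm, eLpNorm_zero, ENNReal.toReal_zero]

end Haar

/-- for `1 < p < ∞` and `m ≥ 0` there is a positive integer
`N = N(p,m)` such that every DGA residual sequence for the dictionary
`{h_i^{(p)} : 0 ≤ i ≤ m}` in `L_p[0,1]`, starting at any vector of the linear
span of the dictionary, satisfies `x_N = 0`.  At each step the selected index
maximizes `|F_{x_{n-1}}(h_i^{(p)})|`, where `F_y` is the norming functional of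
the residual, and the coefficient is chosen by best one-term approximation. -/
theorem stmt_13 (p : ℝ) (hp : 1 < p) (m : ℕ) :
    ∃ N : ℕ, 0 < N ∧
      ∀ (c : ℕ → ℝ) (x : ℕ → ℝ → ℝ),
        x 0 = (fun t => ∑ i ∈ Finset.range (m + 1), c i * haarFnP p i t) →
        (∀ n : ℕ,
          (x n ≠ 0 → ∃ i ≤ m, ∃ lam : ℝ,
            x (n + 1) = (fun t => x n t - lam * haarFnP p i t) ∧
            (∀ j ≤ m, |normingF p (x n) (haarFnP p j)| ≤ |normingF p (x n) (haarFnP p i)|) ∧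
            (∀ t : ℝ,
              pnorm p (fun s => x n s - lam * haarFnP p i s) ≤
                pnorm p (fun s => x n s - t * haarFnP p i s))) ∧
          (x n = 0 → x (n + 1) = 0)) →
        x N = 0 := by
  have hp0 : 0 < p := by linarith
  let h : Fin (m + 1) → ℝ → ℝ := fun j => haarFn j
  obtain ⟨⟨i₀, j₀⟩, hmin⟩ := Finite.exists_min fun q : Fin (m + 1) × Fin (m + 1) =>
    pnorm p (haarFn q.1) / pnorm p (haarFn q.2)
  obtain ⟨N, hNpos, hN⟩ := (isHaarLike_haarFn m).exists_forall_eq_zero hp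
    (div_pos (pnorm_haarFn_pos hp0 i₀) (pnorm_haarFn_pos hp0 j₀))
  refine ⟨N, hNpos, fun c x hx0 hx => ?_⟩
  have hnext : ∀ n e, x n = synth h e → ∃ e', x (n + 1) = synth h e' ∧
      WeakDualGreedyStep p (pnorm p (haarFn i₀) / pnorm p (haarFn j₀))
        (volume.restrict (Set.Ico (0 : ℝ) 1)) h e e' := fun n e he => by
    by_cases h0 : x n = 0
    · obtain rfl : e = 0 := eq_zero_of_synth_eq_zero (he ▸ h0)
      exact ⟨0, ((hx n).2 h0).trans (h0.symm.trans he), weakDualGreedyStep_zero hp _⟩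
    · obtain ⟨i, him, lam, hxn, hgreedy, hbest⟩ := (hx n).1 h0
      have he0 : e ≠ 0 := by
        rintro rfl
        exact h0 (he.trans (funext fun t => by simp [synth]))
      rw [he] at hxn hgreedy hbest
      let k : Fin (m + 1) := ⟨i, Nat.lt_succ_of_le him⟩
      refine ⟨e - Pi.single k (lam / pnorm p (haarFn k)), ?_,
        weakDualGreedyStep_of_haarFnP hp (fun i j => hmin (i, j)) he0 (i := k) hgreedy hbest⟩
      rw [hxn]
      funext t
      rw [synth_sub_single, haarFnP]
      simp only [h, k]
      ring
  choose! nextCoeff hnext_eq hnext_step using hnext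
  let e₀ : Fin (m + 1) → ℝ := fun j => c j / pnorm p (haarFn j)
  let e : ℕ → Fin (m + 1) → ℝ := fun n => Nat.rec e₀ nextCoeff n
  have hxe : ∀ n, x n = synth h (e n) := fun n => by
    induction n with
    | zero =>
      rw [hx0]
      funext t
      rw [Finset.sum_range, synth]
      refine Finset.sum_congr rfl fun j _ => ?_
      change c j * haarFnP p j t = c j / pnorm p (haarFn j) * haarFn j t
      rw [haarFnP]
      ring
    | succ n ih => exact hnext_eq n (e n) ih
  rw [hxe N, hN e fun n => hnext_step n (e n) (hxe n)]
  funext t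
  simp [synth]
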